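/- In the abelian group G = ℤ/5 × ℤ/5 × ℤ/9 (of order 225), the four 8-element subsets B₁ = {(0,0,0),(0,0,1),(0,1,2),(0,4,2),(1,0,3),(1,1,7),(4,0,3),(4,4,7)}, B₂ = {(0,0,0),(0,0,2),(1,4,6),(2,2,7),(2,4,5),(3,1,5),(3,3,7),(4,1,6)}, B₃ = {(0,0,0),(0,0,3),(1,2,1),(1,3,7),(2,0,4),(3,0,4),(4,2,7),(4,3,1)}, B₄ = {(0,0,0),(0,0,4),(0,2,1),(0,3,1),(2,1,3),(2,3,8),(3,2,8),(3,4,3)} form a (225,8,1)-difference family: every nonzero element g of G has exactly one representation g = x − y with x, y belonging to the same block Bᵢ. -/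

import Mathlib

def B5 : Fin 4 → Finset (ZMod 5 × ZMod 5 × ZMod 9) :=
  ![({(0, 0, 0), (0, 0, 1), (0, 1, 2), (0, 4, 2), (1, 0, 3), (1, 1, 7), (4, 0, 3), (4, 4, 7)} : Finset (ZMod 5 × ZMod 5 × ZMod 9)),
    ({(0, 0, 0), (0, 0, 2), (1, 4, 6), (2, 2, 7), (2, 4, 5), (3, 1, 5), (3, 3, 7), (4, 1, 6)} : Finset (ZMod 5 × ZMod 5 × ZMod 9)),
    ({(0, 0, 0), (0, 0, 3), (1, 2, 1), (1, 3, 7), (2, 0, 4), (3, 0, 4), (4, 2, 7), (4, 3, 1)} : Finset (ZMod 5 × ZMod 5 × ZMod 9)),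
    ({(0, 0, 0), (0, 0, 4), (0, 2, 1), (0, 3, 1), (2, 1, 3), (2, 3, 8), (3, 2, 8), (3, 4, 3)} : Finset (ZMod 5 × ZMod 5 × ZMod 9))]

/-- The triples `(i, x, y)` with `x` and `y` distinct elements of the block `B5 i`. -/
def blockPairs :
    Finset (Fin 4 × (ZMod 5 × ZMod 5 × ZMod 9) × (ZMod 5 × ZMod 5 × ZMod 9)) :=
  Finset.univ.biUnion fun i => (B5 i).offDiag.map ⟨Prod.mk i, Prod.mk_right_injective i⟩

theorem mem_blockPairs
    {t : Fin 4 × (ZMod 5 × ZMod 5 × ZMod 9) × (ZMod 5 × ZMod 5 × ZMod 9)} :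
    t ∈ blockPairs ↔ t.2.1 ∈ B5 t.1 ∧ t.2.2 ∈ B5 t.1 ∧ t.2.1 ≠ t.2.2 := by
  obtain ⟨i, x, y⟩ := t
  simp [blockPairs]

theorem card_B5 (i : Fin 4) : (B5 i).card = 8 := by
  revert i
  decide +kernel

theorem card_blockPairs : blockPairs.card = 224 := by
  rw [blockPairs, Finset.card_biUnion]
  · simp [Finset.offDiag_card, card_B5]
  · intro i _ j _ hij
    simp only [Finset.disjoint_left, Finset.mem_map, Function.Embedding.coeFn_mk]
    rintro _ ⟨p, _, rfl⟩ ⟨q, _, h⟩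
    exact hij (congrArg Prod.fst h).symm

/-- The blocks of `B5`, with the coordinates given by their natural number representatives. -/
def natBlocks : Fin 4 → List (ℕ × ℕ × ℕ) :=
  ![[(0, 0, 0), (0, 0, 1), (0, 1, 2), (0, 4, 2), (1, 0, 3), (1, 1, 7), (4, 0, 3), (4, 4, 7)],
    [(0, 0, 0), (0, 0, 2), (1, 4, 6), (2, 2, 7), (2, 4, 5), (3, 1, 5), (3, 3, 7), (4, 1, 6)],
    [(0, 0, 0), (0, 0, 3), (1, 2, 1), (1, 3, 7), (2, 0, 4), (3, 0, 4), (4, 2, 7), (4, 3, 1)],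
    [(0, 0, 0), (0, 0, 4), (0, 2, 1), (0, 3, 1), (2, 1, 3), (2, 3, 8), (3, 2, 8), (3, 4, 3)]]

theorem natCast_mem_B5 (i : Fin 4) :
    ∀ x ∈ natBlocks i, ((x.1, x.2.1, x.2.2) : ZMod 5 × ZMod 5 × ZMod 9) ∈ B5 i := by
  revert i
  decide +kernel

theorem exists_modEq_natBlocks :
    ∀ a ∈ List.range 5, ∀ b ∈ List.range 5, ∀ c ∈ List.range 9, a + b + c ≠ 0 →
      ∃ i, ∃ x ∈ natBlocks i, ∃ y ∈ natBlocks i,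
        x.1 ≡ a + y.1 [MOD 5] ∧ x.2.1 ≡ b + y.2.1 [MOD 5] ∧ x.2.2 ≡ c + y.2.2 [MOD 9] := by
  have key : ((List.range 5).all fun a => (List.range 5).all fun b => (List.range 9).all fun c =>
      (a + b + c).beq 0 || (List.finRange 4).any fun i => (natBlocks i).any fun x =>
        (natBlocks i).any fun y => (x.1 % 5).beq ((a + y.1) % 5) &&
          ((x.2.1 % 5).beq ((b + y.2.1) % 5) && (x.2.2 % 9).beq ((c + y.2.2) % 9))) = true := by
    decide +kernel
  simp only [List.all_eq_true, List.any_eq_true, Bool.or_eq_true, Bool.and_eq_true, Nat.beq_eq,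
    List.mem_finRange, true_and] at key
  exact fun a ha b hb c hc h => (key a ha b hb c hc).resolve_left h

theorem exists_sub_eq_of_ne_zero (g : ZMod 5 × ZMod 5 × ZMod 9) (hg : g ≠ 0) :
    ∃ i, ∃ x ∈ B5 i, ∃ y ∈ B5 i, x - y = g := by
  obtain ⟨a, b, c⟩ := g
  have h : a.val + b.val + c.val ≠ 0 := by
    simpa [Prod.ext_iff, and_assoc] using hg
  obtain ⟨i, x, hx, y, hy, h₁, h₂, h₃⟩ :=
    exists_modEq_natBlocks _ (List.mem_range.mpr a.val_lt) _ (List.mem_range.mpr b.val_lt)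
      _ (List.mem_range.mpr c.val_lt) h
  refine ⟨i, _, natCast_mem_B5 i x hx, _, natCast_mem_B5 i y hy, ?_⟩
  rw [← ZMod.natCast_eq_natCast_iff] at h₁ h₂ h₃
  simp [h₁, h₂, h₃]

theorem image_sub_blockPairs :
    blockPairs.image (fun t => t.2.1 - t.2.2) = Finset.univ.erase 0 := by
  ext g
  simp only [Finset.mem_image, Finset.mem_erase, Finset.mem_univ, and_true]
  constructor
  · rintro ⟨t, ht, rfl⟩
    exact sub_ne_zero.mpr (mem_blockPairs.mp ht).2.2
  · intro hg
    obtain ⟨i, x, hx, y, hy, rfl⟩ := exists_sub_eq_of_ne_zero g hg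
    exact ⟨(i, x, y), mem_blockPairs.mpr ⟨hx, hy, sub_ne_zero.mp hg⟩, rfl⟩

theorem injOn_sub_blockPairs :
    Set.InjOn (fun t : Fin 4 × (ZMod 5 × ZMod 5 × ZMod 9) × (ZMod 5 × ZMod 5 × ZMod 9) =>
      t.2.1 - t.2.2) blockPairs := by
  rw [← Finset.card_image_iff, image_sub_blockPairs, card_blockPairs,
    Finset.card_erase_of_mem (Finset.mem_univ _), Finset.card_univ]
  simp [ZMod.card]

theorem stmt_5 :
    (∀ i : Fin 4, (B5 i).card = 8) ∧
    ∀ g : ZMod 5 × ZMod 5 × ZMod 9, g ≠ 0 →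
      ∃! t : Fin 4 × (ZMod 5 × ZMod 5 × ZMod 9) × (ZMod 5 × ZMod 5 × ZMod 9),
        t.2.1 ∈ B5 t.1 ∧ t.2.2 ∈ B5 t.1 ∧ t.2.1 - t.2.2 = g := by
  refine ⟨card_B5, fun g hg => ?_⟩
  obtain ⟨i, x, hx, y, hy, rfl⟩ := exists_sub_eq_of_ne_zero g hg
  refine ⟨(i, x, y), ⟨hx, hy, rfl⟩, fun t ⟨h₁, h₂, h⟩ => ?_⟩
  refine injOn_sub_blockPairs (mem_blockPairs.mpr ⟨h₁, h₂, ?_⟩)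
    (mem_blockPairs.mpr ⟨hx, hy, sub_ne_zero.mp hg⟩) h
  exact sub_ne_zero.mp (h ▸ hg)
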